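/- Let G be a group acting faithfully by homeomorphisms on a compact Hausdorff topological space X. Suppose there is a basis ℐ for the topology of X consisting of nonempty open sets that are not dense in X, such that (writing ℐ^{(k)} for the set of k-tuples of pairwise disjoint elements of ℐ): (1) (Complements) for every I ∈ ℐ there exists J ∈ ℐ with the complement of I contained in J; (2) (Double transitivity) G preserves ℐ and acts doubly transitively on it: for every two pairs (I,J), (I',J') ∈ ℐ^{(2)} there exists g ∈ G with (gI, gJ) = (I', J'); (3) (Weak triple transitivity) for every g, h ∈ G there exists (M,N,P) ∈ ℐ^{(3)} such that (M,N,P) and (gM, hN, P) lie in the same G-orbit in ℐ^{(3)}; (4) (Local action) for every (I,J,K) ∈ ℐ^{(3)} and all g, h ∈ G with gI = I and hJ = J, there exists b ∈ G whose restriction to I equals that of g, whose restriction to J equals that of h, and whose restriction to K is the identity. Then G has no general type hyperbolic actions: for every isometric action of G on a geodesic Gromov-hyperbolic metric space, G does not contain two independent loxodromic elements. -/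

import Mathlib

noncomputable section

open Metric

/-- The Gromov product of `x` and `y` at `w` with respect to a distance function `d`. -/
def gromovProd {α : Type*} (d : α → α → ℝ) (w x y : α) : ℝ :=
  (d w x + d w y - d x y) / 2

/-- Gromov hyperbolicity via the four-point condition, for an arbitrary distance function. -/
def FourPointHyperbolic {α : Type*} (d : α → α → ℝ) : Prop :=
  ∃ δ : ℝ, 0 ≤ δ ∧ ∀ w x y z : α,
    min (gromovProd d w x z) (gromovProd d w z y) - δ ≤ gromovProd d w x y

/-- A geodesic from `x` to `y`, parametrized by arc length on `[0, dist x y]`. -/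
def IsGeodesicSeg {X : Type*} [MetricSpace X] (x y : X) (f : ℝ → X) : Prop :=
  f 0 = x ∧ f (dist x y) = y ∧
    ∀ s ∈ Set.Icc (0 : ℝ) (dist x y), ∀ t ∈ Set.Icc (0 : ℝ) (dist x y),
      dist (f s) (f t) = |s - t|

/-- A geodesic metric space: any two points are joined by a geodesic. -/
def GeodesicSpace (X : Type*) [MetricSpace X] : Prop :=
  ∀ x y : X, ∃ f : ℝ → X, IsGeodesicSeg x y f

/-- The image (as a set) of a geodesic segment from `x` to `y`. -/
def geodSet {X : Type*} [MetricSpace X] (x y : X) (f : ℝ → X) : Set X :=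
  f '' Set.Icc (0 : ℝ) (dist x y)

/-- `p` lies within distance `δ` of the set `S` (i.e. in the closed `δ`-neighborhood). -/
def WithinDistOf {X : Type*} [MetricSpace X] (δ : ℝ) (p : X) (S : Set X) : Prop :=
  ∃ q ∈ S, dist p q ≤ δ

/-- Rips condition: each side of every geodesic triangle is contained in the union of the
closed `δ`-neighborhoods of the other two sides. -/
def RipsHyperbolic (X : Type*) [MetricSpace X] (δ : ℝ) : Prop :=
  ∀ x y z : X, ∀ fxy fyz fxz : ℝ → X,
    IsGeodesicSeg x y fxy → IsGeodesicSeg y z fyz → IsGeodesicSeg x z fxz →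
      (∀ p ∈ geodSet x y fxy, WithinDistOf δ p (geodSet y z fyz ∪ geodSet x z fxz)) ∧
      (∀ p ∈ geodSet y z fyz, WithinDistOf δ p (geodSet x y fxy ∪ geodSet x z fxz)) ∧
      (∀ p ∈ geodSet x z fxz, WithinDistOf δ p (geodSet x y fxy ∪ geodSet y z fyz))

/-- An (isometric) action of a group `G` on a metric space `X`. -/
structure IsIsomAction (G : Type*) [Group G] (X : Type*) [MetricSpace X]
    (act : G → X → X) : Prop where
  act_one : ∀ x : X, act 1 x = x
  act_mul : ∀ (g h : G) (x : X), act (g * h) x = act g (act h x)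
  isometry : ∀ (g : G) (x y : X), dist (act g x) (act g y) = dist x y

/-- A cobounded action: some (hence any) orbit is coarsely dense. -/
def CoboundedAction {G X : Type*} [Group G] [MetricSpace X] (act : G → X → X) : Prop :=
  ∃ (x : X) (R : ℝ), 0 ≤ R ∧ ∀ y : X, ∃ g : G, dist y (act g x) ≤ R

/-- A quasi-isometric embedding between two "spaces" given by distance functions. -/
def IsQIEmbWith {α β : Type*} (dα : α → α → ℝ) (dβ : β → β → ℝ) (f : α → β) : Prop :=
  ∃ A B : ℝ, 1 ≤ A ∧ 0 ≤ B ∧ ∀ x y : α,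
    dα x y / A - B ≤ dβ (f x) (f y) ∧ dβ (f x) (f y) ≤ A * dα x y + B

/-- The image of `f` is coarsely dense. -/
def CoarselyDenseWith {α β : Type*} (dβ : β → β → ℝ) (f : α → β) : Prop :=
  ∃ C : ℝ, 0 ≤ C ∧ ∀ y : β, ∃ x : α, dβ (f x) y ≤ C

/-- A quasi-isometry between two "spaces" given by distance functions. -/
def IsQuasiIsometryWith {α β : Type*} (dα : α → α → ℝ) (dβ : β → β → ℝ) (f : α → β) : Prop :=
  IsQIEmbWith dα dβ f ∧ CoarselyDenseWith dβ f

/-- The standard distance on `ℤ`. -/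
def zdist : ℤ → ℤ → ℝ := fun m n => |(m : ℝ) - (n : ℝ)|

/-- `g` is loxodromic for the action `act`: for some basepoint `x`, the orbit map
`n ↦ g ^ n • x` is a quasi-isometric embedding of `ℤ`. -/
def LoxodromicWith {G α : Type*} [Group G] (d : α → α → ℝ) (act : G → α → α) (g : G) : Prop :=
  ∃ x : α, IsQIEmbWith zdist d (fun n : ℤ => act (g ^ n) x)

/-- Acylindricity of an action, with respect to a distance function. -/
def AcylindricalWith {G α : Type*} (d : α → α → ℝ) (act : G → α → α) : Prop :=
  ∀ ε : ℝ, 0 < ε → ∃ (R : ℝ) (N : ℕ), 0 ≤ R ∧ ∀ x y : α, R ≤ d x y →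
    {g : G | d x (act g x) ≤ ε ∧ d y (act g y) ≤ ε}.Finite ∧
    Nat.card {g : G | d x (act g x) ≤ ε ∧ d y (act g y) ≤ ε} ≤ N

/-- Two subsets are within finite Hausdorff distance of each other. -/
def FinHausdorffClose {α : Type*} (d : α → α → ℝ) (A B : Set α) : Prop :=
  ∃ C : ℝ, (∀ a ∈ A, ∃ b ∈ B, d a b ≤ C) ∧ (∀ b ∈ B, ∃ a ∈ A, d a b ≤ C)

/-- The positive (`pos = true`) or negative (`pos = false`) orbit ray of `g` at `x`. -/
def orbitRay {G α : Type*} [Group G] (act : G → α → α) (g : G) (x : α) (pos : Bool) : Set α :=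
  Set.range fun n : ℕ => act (g ^ (if pos then (n : ℤ) else -(n : ℤ))) x

/-- Independence of two loxodromic elements with respect to the basepoint `x`: no orbit ray of
`g` is within finite Hausdorff distance of an orbit ray of `h`. -/
def IndepWith {G α : Type*} [Group G] (d : α → α → ℝ) (act : G → α → α) (x : α)
    (g h : G) : Prop :=
  ∀ s t : Bool, ¬ FinHausdorffClose d (orbitRay act g x s) (orbitRay act h x t)

/-- A group is virtually cyclic if it has a cyclic subgroup of finite index. -/
def VirtuallyCyclic (G : Type*) [Group G] : Prop :=
  ∃ H : Subgroup G, IsCyclic ↥H ∧ H.FiniteIndex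

/-- `S` is a generating set of `G`. -/
def IsGenSet {G : Type*} [Group G] (S : Set G) : Prop :=
  Subgroup.closure S = ⊤

/-- The word length of `g` with respect to `S`: the least `n` such that `g` is a product of
`n` elements of `S ∪ S⁻¹`. -/
def wordLength {G : Type*} [Group G] (S : Set G) (g : G) : ℕ :=
  sInf {n : ℕ | ∃ l : List G, l.length = n ∧ (∀ s ∈ l, s ∈ S ∨ s⁻¹ ∈ S) ∧ l.prod = g}

/-- The word metric `d_S(g,h) = ‖g⁻¹h‖_S` on `G`. -/
def wordDist {G : Type*} [Group G] (S : Set G) : G → G → ℝ :=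
  fun g h => (wordLength S (g⁻¹ * h) : ℝ)

/-- `S ⪯ T` : `S` is dominated by `T`, i.e. `sup_{t ∈ T} ‖t‖_S < ∞`. -/
def GenSetDominated {G : Type*} [Group G] (S T : Set G) : Prop :=
  ∃ M : ℕ, ∀ t ∈ T, wordLength S t ≤ M

/-- Equivalence of generating sets: mutual domination. -/
def GenSetEquiv {G : Type*} [Group G] (S T : Set G) : Prop :=
  GenSetDominated S T ∧ GenSetDominated T S

/-- The left multiplication action of a group on itself. -/
def leftTranslation {G : Type*} [Group G] : G → G → G := fun g x => g * x

universe uX uG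

/-- A bundled isometric action of `G` on a geodesic, δ-hyperbolic (Rips condition)
metric space. -/
structure GrpActHypSpace (G : Type uG) [Group G] : Type (max uG (uX + 1)) where
  carrier : Type uX
  [inst : MetricSpace carrier]
  act : G → carrier → carrier
  isIsomAction : IsIsomAction G carrier act
  δ : ℝ
  δ_nonneg : 0 ≤ δ
  geodesic : GeodesicSpace carrier
  rips : RipsHyperbolic carrier δ

attribute [instance] GrpActHypSpace.inst

/-- Property (NL): no isometric action of `G` on a geodesic Gromov-hyperbolic metric space
has a loxodromic element. -/
def PropNL (G : Type uG) [Group G] : Prop :=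
  ∀ A : GrpActHypSpace.{uX, uG} G, ∀ g : G,
    ¬ LoxodromicWith (fun a b : A.carrier => dist a b) A.act g

section Hyperbolic

/-- Four-point hyperbolicity of a metric space with an explicit constant. -/
def FourPointWith (Y : Type*) [MetricSpace Y] (δ : ℝ) : Prop :=
  ∀ w x y z : Y,
    min (gromovProd dist w x z) (gromovProd dist w z y) - δ ≤ gromovProd dist w x y

variable {Y : Type*} [MetricSpace Y]

theorem gromovProd_le_dist_of_mem_geodSet {x y z p : Y} {f : ℝ → Y}
    (hf : IsGeodesicSeg y z f) (hp : p ∈ geodSet y z f) :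
    gromovProd dist x y z ≤ dist x p := by
  obtain ⟨t, ht, rfl⟩ := hp
  obtain ⟨h0, h1, h⟩ := hf
  have hy := h 0 ⟨le_rfl, dist_nonneg⟩ t ht
  have hz := h t ht _ ⟨dist_nonneg, le_rfl⟩
  rw [h0, abs_of_nonpos (by linarith [ht.1])] at hy
  rw [h1, abs_of_nonpos (by linarith [ht.2])] at hz
  have e1 := dist_triangle x (f t) y
  have e2 := dist_triangle x (f t) z
  rw [dist_comm (f t) y] at e1
  unfold gromovProd
  linarith

theorem IsGeodesicSeg.dist_add_dist {y z p : Y} {f : ℝ → Y}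
    (hf : IsGeodesicSeg y z f) (hp : p ∈ geodSet y z f) :
    dist y p + dist p z = dist y z := by
  obtain ⟨t, ht, rfl⟩ := hp
  obtain ⟨h0, h1, h⟩ := hf
  have hy := h 0 ⟨le_rfl, dist_nonneg⟩ t ht
  have hz := h t ht _ ⟨dist_nonneg, le_rfl⟩
  rw [h0, abs_of_nonpos (by linarith [ht.1])] at hy
  rw [h1, abs_of_nonpos (by linarith [ht.2])] at hz
  linarith

theorem RipsHyperbolic.exists_mem_geodSet_dist_le {δ : ℝ} (hδ : 0 ≤ δ)
    (hgeo : GeodesicSpace Y) (hR : RipsHyperbolic Y δ) (x : Y) {y z : Y} {f : ℝ → Y}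
    (hf : IsGeodesicSeg y z f) :
    ∃ p ∈ geodSet y z f, dist x p ≤ gromovProd dist x y z + 2 * (δ + 1) := by
  obtain ⟨a, ha⟩ := hgeo x y
  obtain ⟨b, hb⟩ := hgeo x z
  have hcov := (hR x y z a f b ha hf hb).2.1
  set A : Set ℝ := {t | t ∈ Set.Icc 0 (dist y z) ∧ WithinDistOf δ (f t) (geodSet x y a)} with hA
  have hA0 : (0 : ℝ) ∈ A := by
    refine ⟨⟨le_rfl, dist_nonneg⟩, y, ⟨dist x y, ⟨dist_nonneg, le_rfl⟩, ha.2.1⟩, ?_⟩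
    rw [hf.1, dist_self]
    exact hδ
  have hbdd : BddAbove A := ⟨dist y z, fun t ht => ht.1.2⟩
  have hc0 : 0 ≤ sSup A := le_csSup hbdd hA0
  have hcL : sSup A ≤ dist y z := csSup_le ⟨0, hA0⟩ fun t ht => ht.1.2
  obtain ⟨t, htA, ht⟩ := exists_lt_of_lt_csSup ⟨0, hA0⟩ (show sSup A - 1 / 2 < sSup A by linarith)
  have htc : t ≤ sSup A := le_csSup hbdd htA
  set s : ℝ := min (sSup A + 1 / 2) (dist y z)
  have hs : s ∈ Set.Icc 0 (dist y z) := ⟨le_min (by linarith) dist_nonneg, min_le_right _ _⟩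
  have hts : t ≤ s := le_min (by linarith) (by linarith)
  have hst : s ≤ t + 1 := (min_le_left _ _).trans (by linarith)
  have hsB : WithinDistOf δ (f s) (geodSet x z b) := by
    obtain ⟨q, hq | hq, hd⟩ := hcov (f s) ⟨s, hs, rfl⟩
    · have hsA : s ≤ sSup A := le_csSup hbdd ⟨hs, q, hq, hd⟩
      have hsL : s = dist y z := by
        rcases min_choice (sSup A + 1 / 2) (dist y z) with h | h
        · exact absurd (show s = sSup A + 1 / 2 from h) (by intro h; linarith)
        · exact h
      refine ⟨z, ⟨dist x z, ⟨dist_nonneg, le_rfl⟩, hb.2.1⟩, ?_⟩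
      rw [hsL, hf.2.1, dist_self]
      exact hδ
    · exact ⟨q, hq, hd⟩
  obtain ⟨q, hq, hqd⟩ := htA.2
  obtain ⟨r, hr, hrd⟩ := hsB
  refine ⟨f t, ⟨t, htA.1, rfl⟩, ?_⟩
  have e1 := ha.dist_add_dist hq
  have e2 := hb.dist_add_dist hr
  have e3 := hf.dist_add_dist ⟨t, htA.1, rfl⟩
  have e4 : dist (f t) (f s) ≤ 1 := by
    rw [hf.2.2 t htA.1 s hs, abs_of_nonpos (by linarith)]
    linarith
  have t1 := dist_triangle x q (f t)
  have t2 := dist_triangle (f t) q y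
  have t3 := dist_triangle4 x r (f s) (f t)
  have t4 := dist_triangle4 (f t) (f s) r z
  rw [dist_comm q (f t)] at t1
  rw [dist_comm r (f s), dist_comm (f s) (f t)] at t3
  rw [dist_comm (f t) y] at t2
  unfold gromovProd
  linarith

theorem RipsHyperbolic.fourPointWith {δ : ℝ} (hδ : 0 ≤ δ)
    (hgeo : GeodesicSpace Y) (hR : RipsHyperbolic Y δ) : FourPointWith Y (3 * δ + 2) := by
  intro w x y z
  obtain ⟨a, ha⟩ := hgeo x z
  obtain ⟨b, hb⟩ := hgeo z y
  obtain ⟨c, hc⟩ := hgeo x y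
  obtain ⟨p, hp, hpd⟩ := hR.exists_mem_geodSet_dist_le hδ hgeo w hc
  have key : ∀ q, dist p q ≤ δ → dist w q ≤ gromovProd dist w x y + (3 * δ + 2) := fun q hq => by
    linarith [dist_triangle w p q]
  obtain ⟨q, hq | hq, hd⟩ := (hR x z y a b c ha hb hc).2.2 p hp
  · linarith [min_le_left (gromovProd dist w x z) (gromovProd dist w z y), key q hd,
      gromovProd_le_dist_of_mem_geodSet (x := w) ha hq]
  · linarith [min_le_right (gromovProd dist w x z) (gromovProd dist w z y), key q hd,
      gromovProd_le_dist_of_mem_geodSet (x := w) hb hq]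

theorem gromovProd_comm (w x y : Y) : gromovProd dist w x y = gromovProd dist w y x := by
  unfold gromovProd
  rw [dist_comm x y]
  ring

theorem gromovProd_le_dist_left (w x y : Y) : gromovProd dist w x y ≤ dist w x := by
  unfold gromovProd
  linarith [dist_triangle w x y]

theorem gromovProd_le_dist_right (w x y : Y) : gromovProd dist w x y ≤ dist w y := by
  rw [gromovProd_comm]
  exact gromovProd_le_dist_left w y x

namespace FourPointWith

variable {δ : ℝ}

theorem le_gromovProd_of_le (h : FourPointWith Y δ) {w x y : Y} (z : Y) {r : ℝ}
    (h1 : r ≤ gromovProd dist w x z) (h2 : r ≤ gromovProd dist w z y) :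
    r - δ ≤ gromovProd dist w x y :=
  (sub_le_sub_right (le_min h1 h2) δ).trans (h w x y z)

theorem dist_add_dist_le (h : FourPointWith Y δ) (w x y z : Y) :
    dist x y + dist w z ≤ max (dist x z + dist w y) (dist z y + dist w x) + 2 * δ := by
  have := h w x y z
  unfold gromovProd at this
  rcases min_cases ((dist w x + dist w z - dist x z) / 2) ((dist w z + dist w y - dist z y) / 2)
    with ⟨e, _⟩ | ⟨e, _⟩ <;> rw [e] at this
  · linarith [le_max_left (dist x z + dist w y) (dist z y + dist w x)]
  · linarith [le_max_right (dist x z + dist w y) (dist z y + dist w x)]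

/-- If a sequence `p` stays close to geodesics from `x`, so does `q`, and the two fellow-travel
arbitrarily far, then `p` lies in a bounded neighbourhood of `q`. -/
theorem exists_dist_le (h : FourPointWith Y δ) (hδ : 0 ≤ δ) {x : Y} {p q : ℕ → Y} {E F c : ℝ}
    (hq0 : q 0 = x) (hc : 0 ≤ c)
    (hp : ∀ n k, n ≤ k → dist x (p n) - E ≤ gromovProd dist x (p n) (p k))
    (hq : ∀ n k, n ≤ k → dist x (q n) - F ≤ gromovProd dist x (q n) (q k))
    (hstep : ∀ n, dist (q n) (q (n + 1)) ≤ c)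
    (hpq : ∀ R : ℝ, ∃ k, R ≤ gromovProd dist x (p k) (q k)) (hE : 0 ≤ E) (hF : 0 ≤ F) :
    ∀ n, ∃ m, dist (p n) (q m) ≤ c + 2 * (E + F + 2 * δ) := by
  classical
  intro n
  obtain ⟨M, hM⟩ : ∃ M : ℝ, ∀ i ≤ n, dist x (p i) ≤ M := by
    obtain ⟨M, hM⟩ := ((Finset.range (n + 1)).image fun i => dist x (p i)).bddAbove
    refine ⟨M, fun i hi => hM ?_⟩
    simpa using ⟨i, by omega, rfl⟩
  obtain ⟨k, hk⟩ := hpq (M + 1 + E)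
  have hnk : n ≤ k := by
    by_contra hlt
    linarith [hM k (by omega), gromovProd_le_dist_left x (p k) (q k)]
  have hpn := hM n le_rfl
  have hqk : dist x (p n) ≤ dist x (q k) := by
    linarith [gromovProd_le_dist_right x (p k) (q k)]
  have hex : ∃ m, dist x (p n) ≤ dist x (q m) := ⟨k, hqk⟩
  obtain ⟨m, hmk, hm1, hm2⟩ : ∃ m, m ≤ k ∧ dist x (p n) ≤ dist x (q m) ∧
      dist x (q m) ≤ dist x (p n) + c := by
    refine ⟨Nat.find hex, Nat.find_min' hex hqk, Nat.find_spec hex, ?_⟩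
    rcases hm : Nat.find hex with _ | j
    · rw [hq0, dist_self]
      positivity
    · have hj := Nat.find_min hex (m := j) (by omega)
      linarith [dist_triangle x (q j) (q (j + 1)), hstep j]
  refine ⟨m, ?_⟩
  have h1 := h.le_gromovProd_of_le (w := x) (x := p n) (y := q k) (p k)
    (r := dist x (p n) - E) (hp n k hnk) (by linarith)
  have h2 := h.le_gromovProd_of_le (w := x) (x := p n) (y := q m) (q k)
    (r := dist x (p n) - E - F - δ) (by linarith) (by
      rw [gromovProd_comm]
      linarith [hq m k hmk])
  unfold gromovProd at h2
  linarith

end FourPointWith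

end Hyperbolic

section IsometricAction

variable {G : Type*} [Group G] {Y : Type*} [MetricSpace Y] [MulAction G Y]

/-- The linear growth of the displacement that characterises loxodromic isometries. -/
def LinearGrowth (g : G) (x : Y) : Prop :=
  ∃ A B : ℝ, 0 < A ∧ ∀ n : ℕ, n / A - B ≤ dist x (g ^ n • x)

theorem LinearGrowth.exists_doubling {g : G} {x : Y} (h : LinearGrowth g x) (K : ℝ) :
    ∃ N : ℕ, dist x (g ^ N • x) + K ≤ dist x (g ^ (N + N) • x) := by
  obtain ⟨A, B, hA, h⟩ := h
  by_contra! hlt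
  have hle : ∀ j : ℕ, dist x (g ^ (2 ^ j) • x) ≤ dist x (g • x) + j * K := by
    intro j
    induction j with
    | zero => simp
    | succ j ih =>
      have := hlt (2 ^ j)
      rw [← two_mul, ← pow_succ'] at this
      push_cast
      linarith
  set C := dist x (g • x) + B
  have hlim : Filter.Tendsto (fun j : ℕ => (C * A) * ((j : ℝ) ^ 0 / 2 ^ j) +
      (K * A) * ((j : ℝ) ^ 1 / 2 ^ j)) Filter.atTop (nhds ((C * A) * 0 + (K * A) * 0)) :=
    ((tendsto_pow_const_div_const_pow_of_one_lt 0 one_lt_two).const_mul _).add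
      ((tendsto_pow_const_div_const_pow_of_one_lt 1 one_lt_two).const_mul _)
  obtain ⟨j, hj⟩ := (hlim.eventually_lt_const (by simp : _ < (1 : ℝ))).exists
  have hpos : (0 : ℝ) < 2 ^ j := by positivity
  have e : C * A * ((j : ℝ) ^ 0 / 2 ^ j) + K * A * ((j : ℝ) ^ 1 / 2 ^ j)
      = ((C + j * K) * A) / 2 ^ j := by
    field_simp
  rw [e, div_lt_one hpos] at hj
  have h1 := h (2 ^ j)
  push_cast at h1
  have h2 : (2 : ℝ) ^ j / A ≤ C + j * K := by linarith [hle j]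
  rw [div_le_iff₀ hA] at h2
  linarith

variable [IsIsometricSMul G Y] {δ : ℝ}

theorem dist_inv_smul_self (g : G) (x : Y) : dist x (g⁻¹ • x) = dist x (g • x) := by
  rw [← dist_smul g x (g⁻¹ • x), smul_inv_smul, dist_comm]

theorem dist_pow_smul_pow_smul (g : G) (x : Y) {m n : ℕ} (h : m ≤ n) :
    dist (g ^ m • x) (g ^ n • x) = dist x (g ^ (n - m) • x) := by
  obtain ⟨k, rfl⟩ := Nat.exists_eq_add_of_le h
  rw [pow_add, mul_smul, dist_smul, Nat.add_sub_cancel_left]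

theorem dist_pow_smul_le (g : G) (x : Y) (n : ℕ) :
    dist x (g ^ n • x) ≤ n * dist x (g • x) := by
  induction n with
  | zero => simp
  | succ n ih =>
    have h := dist_triangle x (g ^ n • x) (g ^ (n + 1) • x)
    rw [dist_pow_smul_pow_smul g x (Nat.le_succ n)] at h
    simp only [Nat.add_sub_cancel_left, Nat.succ_eq_add_one, pow_one] at h
    push_cast
    linarith

theorem gromovProd_smul_smul_ge (g : G) (x y z : Y) :
    gromovProd dist x y z - dist x (g • x) ≤ gromovProd dist x (g • y) (g • z) := by
  have h1 := dist_triangle (g • x) x (g • y)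
  have h2 := dist_triangle (g • x) x (g • z)
  rw [dist_smul, dist_comm (g • x) x] at h1 h2
  unfold gromovProd
  rw [dist_smul]
  linarith

theorem LinearGrowth.inv {g : G} {x : Y} (h : LinearGrowth g x) : LinearGrowth g⁻¹ x := by
  obtain ⟨A, B, hA, h⟩ := h
  exact ⟨A, B, hA, fun n => by rw [inv_pow, dist_inv_smul_self]; exact h n⟩

theorem LinearGrowth.congr {g : G} {x : Y} (h : LinearGrowth g x) (y : Y) : LinearGrowth g y := by
  obtain ⟨A, B, hA, h⟩ := h
  refine ⟨A, B + 2 * dist x y, hA, fun n => ?_⟩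
  have t := dist_triangle4 x y (g ^ n • y) (g ^ n • x)
  rw [dist_smul, dist_comm y x] at t
  linarith [h n]

theorem LinearGrowth.exists_lt_dist {g : G} {x : Y} (h : LinearGrowth g x) (D : ℝ) :
    ∃ n : ℕ, ∀ y : Y, D < dist y (g ^ n • y) := by
  obtain ⟨A, B, hA, h⟩ := h
  obtain ⟨n, hn⟩ := exists_nat_gt ((D + 1) * A)
  have hn' : D + 1 < n / A := by rwa [lt_div_iff₀ hA]
  refine ⟨n, fun y => ?_⟩
  by_contra! hle
  obtain ⟨m, hm⟩ := exists_nat_gt (B + 2 * dist x y)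
  have h1 := h (n * m)
  have t := dist_triangle4 x y (g ^ (n * m) • y) (g ^ (n * m) • x)
  rw [dist_smul, dist_comm y x] at t
  have h2 := dist_pow_smul_le (g ^ n) y m
  rw [← pow_mul] at h2
  have h3 : (m : ℝ) * dist y (g ^ n • y) ≤ m * D := by gcongr
  have h4 : (m : ℝ) * (D + 1) ≤ m * (n / A) := by gcongr
  push_cast at h1
  have h5 : (n : ℝ) * m / A = m * (n / A) := by ring
  linarith

theorem FourPointWith.dist_add_dist_pow_le (hY : FourPointWith Y δ) (g : G) (x : Y)
    (p q r : ℕ) :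
    dist x (g ^ (p + q) • x) + dist x (g ^ (q + r) • x) ≤
      max (dist x (g ^ p • x) + dist x (g ^ r • x))
        (dist x (g ^ (p + q + r) • x) + dist x (g ^ q • x)) + 2 * δ := by
  have h := hY.dist_add_dist_le x (g ^ p • x) (g ^ (p + q + r) • x) (g ^ (p + q) • x)
  rw [dist_pow_smul_pow_smul g x (by omega), dist_pow_smul_pow_smul g x (by omega),
    dist_pow_smul_pow_smul g x (by omega), show p + q + r - p = q + r by omega,
    show p + q - p = q by omega, show p + q + r - (p + q) = r by omega] at h
  rw [max_comm, add_comm (dist x (g ^ p • x)), add_comm (dist x (g ^ (p + q + r) • x)),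
    add_comm (dist x (g ^ (p + q) • x))]
  exact h

/-- Displacements of powers of a loxodromic isometry are coarsely superadditive. -/
theorem FourPointWith.exists_dist_pow_add_ge (hY : FourPointWith Y δ) (hδ : 0 ≤ δ) {g : G} {x : Y}
    (hg : LinearGrowth g x) :
    ∃ E : ℝ, 0 ≤ E ∧ ∀ n m : ℕ,
      dist x (g ^ n • x) + dist x (g ^ m • x) - E ≤ dist x (g ^ (n + m) • x) := by
  obtain ⟨N, hN⟩ := hg.exists_doubling (3 * δ + 1)
  set a : ℕ → ℝ := fun n => dist x (g ^ n • x) with ha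
  have a0 : a 0 = 0 := by simp [ha]
  have asub : ∀ i j, a (i + j) ≤ a i + a j := fun i j => by
    have := dist_triangle x (g ^ i • x) (g ^ (i + j) • x)
    rwa [dist_pow_smul_pow_smul g x (by omega), Nat.add_sub_cancel_left] at this
  have asub' : ∀ i j, a i ≤ a (i + j) + a j := fun i j => by
    have := dist_triangle x (g ^ (i + j) • x) (g ^ i • x)
    rwa [dist_comm (g ^ (i + j) • x), dist_pow_smul_pow_smul g x (by omega),
      Nat.add_sub_cancel_left] at this
  have four : ∀ p q r, a (p + q) + a (q + r) ≤ max (a p + a r) (a (p + q + r) + a q) + 2 * δ :=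
    fun p q r => hY.dist_add_dist_pow_le g x p q r
  replace hN : a N + (3 * δ + 1) ≤ a (N + N) := hN
  have step : ∀ j : ℕ, a (j * N) + (δ + 1) ≤ a ((j + 1) * N) := by
    intro j
    induction j with
    | zero => simp only [zero_mul, zero_add, one_mul, a0]; linarith [asub N N]
    | succ j ih =>
      have := four (j * N) N N
      rw [show j * N + N = (j + 1) * N by ring,
        show (j + 1) * N + N = (j + 1 + 1) * N by ring] at this
      rcases le_max_iff.1 (sub_le_iff_le_add.2 this) with h | h <;> linarith
  have big : ∀ i j : ℕ, a (i * N) + a (j * N) - (a N + 2 * δ) ≤ a ((i + j) * N) := by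
    intro i j
    have hnn : ∀ k, 0 ≤ a k := fun k => dist_nonneg
    rcases i with _ | i
    · simp only [zero_mul, zero_add, a0]; linarith [hnn N]
    rcases j with _ | j
    · simp only [zero_mul, add_zero, a0]; linarith [hnn N]
    have := four (i * N) N (j * N)
    have e : a (i * N + N + j * N) ≤ a ((i + 1 + (j + 1)) * N) := by
      have := step (i + 1 + j)
      rw [show i * N + N + j * N = (i + 1 + j) * N by ring]
      rw [show i + 1 + (j + 1) = i + 1 + j + 1 by ring]
      linarith
    rw [show i * N + N = (i + 1) * N by ring, show N + j * N = (j + 1) * N by ring] at this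
    rw [show i * N + N = (i + 1) * N by ring] at e
    rcases le_max_iff.1 (sub_le_iff_le_add.2 this) with h | h
    · linarith [step i, step j]
    · linarith
  obtain ⟨D, hD⟩ : ∃ D : ℝ, ∀ r < N, a r ≤ D := by
    obtain ⟨D, hD⟩ := ((Finset.range N).image a).bddAbove
    exact ⟨D, fun r hr => hD (by simpa using ⟨r, hr, rfl⟩)⟩
  have hNpos : 0 < N := by
    rcases Nat.eq_zero_or_pos N with rfl | h
    · simp only [add_zero, a0] at hN; linarith
    · exact h
  have hD0 : 0 ≤ D := a0 ▸ hD 0 hNpos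
  refine ⟨a N + 2 * δ + 4 * D, by positivity, fun n m => ?_⟩
  have dn := Nat.div_add_mod' n N
  have dm := Nat.div_add_mod' m N
  have rn := hD _ (Nat.mod_lt n hNpos)
  have rm := hD _ (Nat.mod_lt m hNpos)
  have h1 := asub (n / N * N) (n % N)
  have h2 := asub (m / N * N) (m % N)
  have h3 := big (n / N) (m / N)
  have h4 := asub' ((n / N + m / N) * N) (n % N + m % N)
  have h5 := asub (n % N) (m % N)
  rw [show (n / N + m / N) * N + (n % N + m % N) = n + m by rw [add_mul]; omega] at h4
  rw [dn] at h1
  rw [dm] at h2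
  change a n + a m - _ ≤ a (n + m)
  linarith

theorem FourPointWith.exists_dist_pow_sub_le_gromovProd (hY : FourPointWith Y δ) (hδ : 0 ≤ δ)
    {g : G} {x : Y} (hg : LinearGrowth g x) :
    ∃ E : ℝ, 0 ≤ E ∧ ∀ n k : ℕ, n ≤ k →
      dist x (g ^ n • x) - E ≤ gromovProd dist x (g ^ n • x) (g ^ k • x) := by
  obtain ⟨E, hE, h⟩ := hY.exists_dist_pow_add_ge hδ hg
  refine ⟨E, hE, fun n k hnk => ?_⟩
  have := h n (k - n)
  rw [Nat.add_sub_cancel' hnk] at this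
  unfold gromovProd
  rw [dist_pow_smul_pow_smul g x hnk]
  linarith

/-- Positive orbit rays of loxodromic isometries which fellow-travel arbitrarily far are at finite
Hausdorff distance. -/
theorem FourPointWith.finHausdorffClose_range_pow (hY : FourPointWith Y δ) (hδ : 0 ≤ δ)
    {g h : G} {x : Y} (hg : LinearGrowth g x) (hh : LinearGrowth h x)
    (hgh : ∀ R : ℝ, ∃ k : ℕ, R ≤ gromovProd dist x (g ^ k • x) (h ^ k • x)) :
    FinHausdorffClose dist (Set.range fun n : ℕ => g ^ n • x)
      (Set.range fun n : ℕ => h ^ n • x) := by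
  obtain ⟨E, hE, hp⟩ := hY.exists_dist_pow_sub_le_gromovProd hδ hg
  obtain ⟨F, hF, hq⟩ := hY.exists_dist_pow_sub_le_gromovProd hδ hh
  have hstep : ∀ (f : G) (n : ℕ), dist (f ^ n • x) (f ^ (n + 1) • x) ≤ dist x (f • x) :=
    fun f n => by rw [dist_pow_smul_pow_smul f x (by omega)]; simp
  have h1 := hY.exists_dist_le hδ (p := fun n => g ^ n • x) (q := fun n => h ^ n • x)
    (by simp) dist_nonneg hp hq (hstep h) hgh hE hF
  have h2 := hY.exists_dist_le hδ (p := fun n => h ^ n • x) (q := fun n => g ^ n • x)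
    (by simp) dist_nonneg hq hp (hstep g)
    (fun R => (hgh R).imp fun k hk => by rwa [gromovProd_comm]) hF hE
  refine ⟨max (dist x (h • x) + 2 * (E + F + 2 * δ)) (dist x (g • x) + 2 * (F + E + 2 * δ)),
    ?_, ?_⟩
  · rintro _ ⟨n, rfl⟩
    obtain ⟨m, hm⟩ := h1 n
    exact ⟨_, ⟨m, rfl⟩, hm.trans (le_max_left _ _)⟩
  · rintro _ ⟨n, rfl⟩
    obtain ⟨m, hm⟩ := h2 n
    refine ⟨_, ⟨m, rfl⟩, ?_⟩
    rw [dist_comm]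
    exact hm.trans (le_max_right _ _)

/-- In the quadrilateral `x, f • x, f • z, z`, the point `z` is seen from `x` in the direction of
`f • x` or of `f⁻¹ • x`. -/
theorem FourPointWith.min_le_gromovProd_add (hY : FourPointWith Y δ) (f : G) (x z : Y) :
    min (dist x (f • x)) (dist x z + (dist x (f • x) - dist z (f • z)) / 2) - δ ≤
      gromovProd dist x z (f • x) + gromovProd dist x z (f⁻¹ • x) := by
  have h := hY.dist_add_dist_le x (f • x) z (f • z)
  have e : dist z (f⁻¹ • x) = dist x (f • z) := by
    rw [← dist_smul f, smul_inv_smul, dist_comm]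
  unfold gromovProd
  rw [dist_inv_smul_self, e, dist_comm z (f • x)]
  rw [dist_smul, dist_comm (f • z) z] at h
  rcases le_max_iff.1 (sub_le_iff_le_add.2 h) with h | h
  · linarith [min_le_left (dist x (f • x))
      (dist x z + (dist x (f • x) - dist z (f • z)) / 2)]
  · linarith [min_le_right (dist x (f • x))
      (dist x z + (dist x (f • x) - dist z (f • z)) / 2)]

theorem FourPointWith.le_gromovProd_or_of_commute (hY : FourPointWith Y δ) {f k : G}
    (hfk : Commute f k) {x : Y} {L : ℝ} (hf : L ≤ dist x (f • x)) (hk : L ≤ dist x (k • x)) :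
    (L - δ) / 2 ≤ gromovProd dist x (k • x) (f • x) ∨
      (L - δ) / 2 ≤ gromovProd dist x (k • x) (f⁻¹ • x) := by
  have h := hY.min_le_gromovProd_add f x (k • x)
  rw [← mul_smul f k, hfk.eq, mul_smul, dist_smul, sub_self, zero_div, add_zero] at h
  have := le_min hf hk
  by_contra! hlt
  linarith [hlt.1, hlt.2]

theorem FourPointWith.le_gromovProd_or_of_le (hY : FourPointWith Y δ) (f : G) {x z : Y}
    (hz : dist x (f • x) ≤ gromovProd dist x z (f • z)) :
    (dist x (f • x) - δ) / 2 ≤ gromovProd dist x z (f • x) ∨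
      (dist x (f • x) - δ) / 2 ≤ gromovProd dist x z (f⁻¹ • x) := by
  have h := hY.min_le_gromovProd_add f x z
  have hle : dist x (f • x) ≤ min (dist x (f • x))
      (dist x z + (dist x (f • x) - dist z (f • z)) / 2) := by
    refine le_min le_rfl ?_
    have t := dist_triangle x (f • x) (f • z)
    rw [dist_smul] at t
    unfold gromovProd at hz
    linarith
  by_contra! hlt
  linarith [hlt.1, hlt.2]

end IsometricAction

section Dynamics

open Pointwise

variable {G : Type*} [Group G] {X : Type*} [MulAction G X]

theorem commute_of_mem_fixingSubgroup_of_union_eq_univ [FaithfulSMul G X] {I J : Set X}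
    (hIJ : I ∪ J = Set.univ) {f k : G} (hf : f ∈ fixingSubgroup G I)
    (hk : k ∈ fixingSubgroup G J) : Commute f k := by
  rw [mem_fixingSubgroup_iff] at hf hk
  have hd : Equiv.Perm.Disjoint (MulAction.toPermHom G X f) (MulAction.toPermHom G X k) := by
    intro y
    rcases (hIJ ▸ Set.mem_univ y : y ∈ I ∪ J) with hy | hy
    · exact Or.inl (hf y hy)
    · exact Or.inr (hk y hy)
  exact hd.commute.of_map MulAction.toPerm_injective

theorem exists_smul_eq_of_disjoint_transitive [TopologicalSpace X] {Bs : Set (Set X)}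
    (hbasis : TopologicalSpace.IsTopologicalBasis Bs) (hnd : ∀ I ∈ Bs, ¬ Dense I)
    (h2T : ∀ I J I' J' : Set X, I ∈ Bs → J ∈ Bs → Disjoint I J →
      I' ∈ Bs → J' ∈ Bs → Disjoint I' J' → ∃ g : G, g • I = I' ∧ g • J = J')
    {I I' : Set X} (hI : I ∈ Bs) (hI' : I' ∈ Bs) : ∃ g : G, g • I = I' := by
  have hdisj : ∀ I ∈ Bs, ∃ J ∈ Bs, Disjoint I J := by
    intro I hI
    obtain ⟨y, hy⟩ := not_forall.1 (hnd I hI)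
    obtain ⟨J, hJ, -, hJI⟩ := hbasis.exists_subset_of_mem_open
      (show y ∈ (closure I)ᶜ from hy) isClosed_closure.isOpen_compl
    exact ⟨J, hJ, Set.disjoint_left.2 fun z hz hzJ => hJI hzJ (subset_closure hz)⟩
  obtain ⟨J, hJ, hd⟩ := hdisj I hI
  obtain ⟨J', hJ', hd'⟩ := hdisj I' hI'
  obtain ⟨g, hg, -⟩ := h2T I J I' J' hI hJ hd hI' hJ' hd'
  exact ⟨g, hg⟩

/-- Every group element is a product of two elements fixing pointwise disjoint basic sets. -/
theorem exists_mul_eq_of_weak_triple_transitive {Bs : Set (Set X)}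
    (h3T : ∀ g h : G, ∃ M N P : Set X, M ∈ Bs ∧ N ∈ Bs ∧ P ∈ Bs ∧
      Disjoint M N ∧ Disjoint M P ∧ Disjoint N P ∧
      ∃ b : G, b • M = g • M ∧ b • N = h • N ∧ b • P = P)
    (hL : ∀ I J K : Set X, I ∈ Bs → J ∈ Bs → K ∈ Bs →
      Disjoint I J → Disjoint I K → Disjoint J K →
      ∀ g h : G, g • I = I → h • J = J →
        ∃ b : G, (∀ x ∈ I, b • x = g • x) ∧ (∀ x ∈ J, b • x = h • x) ∧ (∀ x ∈ K, b • x = x))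
    (g : G) :
    ∃ P ∈ Bs, ∃ M ∈ Bs, Disjoint P M ∧
      ∃ a ∈ fixingSubgroup G P, ∃ b ∈ fixingSubgroup G M, a * b = g := by
  obtain ⟨M, N, P, hM, hN, hP, hMN, hMP, hNP, b, hbM, -, hbP⟩ := h3T g 1
  have hgbM : (g⁻¹ * b) • M = M := by rw [mul_smul, hbM, inv_smul_smul]
  obtain ⟨c, hcM, hcP, -⟩ := hL M P N hM hP hN hMP hMN hNP.symm (g⁻¹ * b) b hgbM hbP
  have hfixM : ∀ y ∈ M, b • c⁻¹ • y = g • y := by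
    intro y hy
    rw [← hgbM] at hy
    obtain ⟨u, hu, rfl⟩ := hy
    simp only
    rw [← hcM u hu, inv_smul_smul, hcM u hu, mul_smul, smul_inv_smul]
  have hfixP : ∀ y ∈ P, b • c⁻¹ • y = y := by
    intro y hy
    rw [← hbP] at hy
    obtain ⟨u, hu, rfl⟩ := hy
    simp only
    rw [← hcP u hu, inv_smul_smul, hcP u hu]
  refine ⟨P, hP, M, hM, hMP.symm, b * c⁻¹, ?_, (b * c⁻¹)⁻¹ * g, ?_, by group⟩ <;>
    rw [mem_fixingSubgroup_iff] <;> intro y hy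
  · rw [mul_smul, hfixP y hy]
  · rw [mul_smul, ← hfixM y hy, ← mul_smul b, inv_smul_smul]

variable {Y : Type*} [MetricSpace Y] [MulAction G Y] [IsIsometricSMul G Y] {δ : ℝ}

theorem dist_smul_le_of_smul_eq {I I' : Set X} {g : G} (hg : g • I = I') {x : Y} {D : ℝ}
    (hD : ∀ f ∈ fixingSubgroup G I, dist x (f • x) ≤ D) :
    ∀ f ∈ fixingSubgroup G I', dist x (f • x) ≤ D + 2 * dist x (g • x) := by
  intro f hf
  have hg' : g⁻¹ • I' = I := by rw [← hg, inv_smul_smul]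
  have h := hD _ (Set.conj_mem_fixingSubgroup hg' hf)
  rw [MulAut.conj_apply, inv_inv, mul_smul, mul_smul, ← dist_smul g, smul_inv_smul] at h
  have t := dist_triangle4 x (g • x) (f • g • x) (f • x)
  rw [dist_smul f, dist_comm (g • x) x] at t
  linarith

/-- If the pointwise fixer of some basic set has bounded orbits, no element is loxodromic. -/
theorem not_linearGrowth_of_bounded {Bs : Set (Set X)}
    (htrans : ∀ I ∈ Bs, ∀ I' ∈ Bs, ∃ g : G, g • I = I')
    (h2T : ∀ I J I' J' : Set X, I ∈ Bs → J ∈ Bs → Disjoint I J →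
      I' ∈ Bs → J' ∈ Bs → Disjoint I' J' → ∃ g : G, g • I = I' ∧ g • J = J')
    (hfac : ∀ g : G, ∃ P ∈ Bs, ∃ M ∈ Bs, Disjoint P M ∧
      ∃ a ∈ fixingSubgroup G P, ∃ b ∈ fixingSubgroup G M, a * b = g)
    {I : Set X} (hI : I ∈ Bs) {x : Y} {D : ℝ}
    (hD : ∀ f ∈ fixingSubgroup G I, dist x (f • x) ≤ D) (g : G) : ¬ LinearGrowth g x := by
  intro hg
  obtain ⟨P, hP, M, hM, hPM, -⟩ := hfac 1
  obtain ⟨u, hu⟩ := htrans I hI P hP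
  obtain ⟨v, hv⟩ := htrans I hI M hM
  have hDP := dist_smul_le_of_smul_eq hu hD
  have hDM := dist_smul_le_of_smul_eq hv hD
  obtain ⟨n, hn⟩ := hg.exists_lt_dist (D + 2 * dist x (u • x) + (D + 2 * dist x (v • x)))
  obtain ⟨P', hP', M', hM', hPM', a, ha, b, hb, hab⟩ := hfac (g ^ n)
  obtain ⟨c, hcP, hcM⟩ := h2T P' M' P M hP' hM' hPM' hP hM hPM
  have ha' := hDP _ (Set.conj_mem_fixingSubgroup hcP ha)
  have hb' := hDM _ (Set.conj_mem_fixingSubgroup hcM hb)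
  have hlt := hn (c⁻¹ • x)
  rw [← hab, ← dist_smul c (c⁻¹ • x), smul_inv_smul,
    show c • (a * b) • c⁻¹ • x = (MulAut.conj c a) • (MulAut.conj c b) • x by
      simp only [MulAut.conj_apply, ← mul_smul]; group] at hlt
  have t := dist_triangle x (MulAut.conj c a • x) (MulAut.conj c a • MulAut.conj c b • x)
  rw [dist_smul (MulAut.conj c a)] at t
  linarith

variable [FaithfulSMul G X] [TopologicalSpace X] {Bs : Set (Set X)}

theorem exists_mem_fixingSubgroup_gromovProd_ge (hY : FourPointWith Y δ) (hδ : 0 ≤ δ)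
    (hbasis : TopologicalSpace.IsTopologicalBasis Bs) (hC : ∀ I ∈ Bs, ∃ J ∈ Bs, Iᶜ ⊆ J) {x : Y}
    (hunb : ∀ I ∈ Bs, ∀ D : ℝ, ∃ f ∈ fixingSubgroup G I, D < dist x (f • x))
    {J₀ J : Set X} (hJ₀ : J₀ ∈ Bs) (hJ : J ∈ Bs) {k₀ : G} (hk₀ : k₀ ∈ fixingSubgroup G J₀) {L : ℝ}
    (hL : L ≤ dist x (k₀ • x)) :
    ∃ k ∈ fixingSubgroup G J, L ≤ dist x (k • x) ∧
      (L - 3 * δ) / 2 ≤ gromovProd dist x (k₀ • x) (k • x) := by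
  have pass : ∀ I ∈ Bs, ∀ Q ∈ Bs, I ∪ Q = Set.univ → ∀ h ∈ fixingSubgroup G I,
      L ≤ dist x (h • x) → ∃ k ∈ fixingSubgroup G Q, L ≤ dist x (k • x) ∧
        (L - δ) / 2 ≤ gromovProd dist x (h • x) (k • x) := by
    intro I hI Q hQ hIQ h hh hLh
    obtain ⟨f, hf, hLf⟩ := hunb Q hQ L
    have hcomm := commute_of_mem_fixingSubgroup_of_union_eq_univ
      ((Set.union_comm Q I).trans hIQ) hf hh
    rcases hY.le_gromovProd_or_of_commute hcomm hLf.le hLh with h1 | h1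
    · exact ⟨f, hf, hLf.le, h1⟩
    · exact ⟨f⁻¹, inv_mem hf, by rw [dist_inv_smul_self]; exact hLf.le, h1⟩
  by_cases hd : Disjoint J₀ J
  · obtain ⟨Q, hQ, hJQ⟩ := hC J₀ hJ₀
    obtain ⟨k, hk, hLk, hg⟩ := pass J₀ hJ₀ Q hQ (Set.compl_subset_iff_union.1 hJQ) k₀ hk₀ hL
    exact ⟨k, fixingSubgroup_antitone G X (hd.subset_compl_left.trans hJQ) hk, hLk, by linarith⟩
  · obtain ⟨y, hy₀, hy⟩ := Set.not_disjoint_iff.1 hd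
    obtain ⟨I, hI, -, hIsub⟩ := hbasis.exists_subset_of_mem_open (Set.mem_inter hy₀ hy)
      ((hbasis.isOpen hJ₀).inter (hbasis.isOpen hJ))
    obtain ⟨Q, hQ, hIQ⟩ := hC I hI
    have hcov : ∀ K, I ⊆ K → K ∪ Q = Set.univ := fun K hK =>
      Set.compl_subset_iff_union.1 ((Set.compl_subset_compl.2 hK).trans hIQ)
    obtain ⟨k, hk, hLk, hg⟩ := pass J₀ hJ₀ Q hQ
      (hcov J₀ (hIsub.trans Set.inter_subset_left)) k₀ hk₀ hL
    obtain ⟨k', hk', hLk', hg'⟩ := pass Q hQ J hJ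
      ((Set.union_comm Q J).trans (hcov J (hIsub.trans Set.inter_subset_right))) k hk hLk
    exact ⟨k', hk', hLk', by linarith [hY.le_gromovProd_of_le (k • x) hg hg']⟩

/-- Elements fixing some basic set pointwise coarsely fix the direction of any far away orbit point
of a pointwise fixer. -/
theorem gromovProd_smul_ge_of_mem_fixingSubgroup (hY : FourPointWith Y δ) (hδ : 0 ≤ δ)
    (hbasis : TopologicalSpace.IsTopologicalBasis Bs) (hC : ∀ I ∈ Bs, ∃ J ∈ Bs, Iᶜ ⊆ J) {x : Y}
    (hunb : ∀ I ∈ Bs, ∀ D : ℝ, ∃ f ∈ fixingSubgroup G I, D < dist x (f • x))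
    {I J₀ : Set X} (hI : I ∈ Bs) (hJ₀ : J₀ ∈ Bs) {f k₀ : G} (hf : f ∈ fixingSubgroup G I)
    (hk₀ : k₀ ∈ fixingSubgroup G J₀) {L : ℝ} (hL0 : 0 ≤ L) (hL : L ≤ dist x (k₀ • x)) :
    (L - 3 * δ) / 2 - dist x (f • x) - 2 * δ ≤ gromovProd dist x (k₀ • x) (f • k₀ • x) := by
  obtain ⟨J, hJ, hIJ⟩ := hC I hI
  obtain ⟨k, hk, hLk, hg⟩ :=
    exists_mem_fixingSubgroup_gromovProd_ge hY hδ hbasis hC hunb hJ₀ hJ hk₀ hL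
  have hcomm := commute_of_mem_fixingSubgroup_of_union_eq_univ
    (Set.compl_subset_iff_union.1 hIJ) hf hk
  have h1 : (L - 3 * δ) / 2 - dist x (f • x) ≤ gromovProd dist x (k • x) (f • k • x) := by
    have t := dist_triangle x (f • k • x) (k • x)
    have e : dist (k • x) (f • k • x) = dist x (f • x) := by
      rw [← mul_smul, hcomm.eq, mul_smul, dist_smul]
    rw [dist_comm (f • k • x), e] at t
    unfold gromovProd
    rw [e]
    linarith
  have h2 : (L - 3 * δ) / 2 - dist x (f • x) ≤ gromovProd dist x (f • k • x) (f • k₀ • x) := by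
    have := gromovProd_smul_smul_ge f x (k • x) (k₀ • x)
    rw [gromovProd_comm] at hg
    linarith
  have h3 := hY.le_gromovProd_of_le (f • k • x) h1 h2
  have h4 := hY.le_gromovProd_of_le (w := x) (x := k₀ • x) (y := f • k₀ • x) (k • x)
    (r := (L - 3 * δ) / 2 - dist x (f • x) - δ) (by linarith [dist_nonneg (x := x) (y := f • x)])
    (by linarith)
  linarith

theorem exists_forall_le_gromovProd_smul (hY : FourPointWith Y δ) (hδ : 0 ≤ δ)
    (hbasis : TopologicalSpace.IsTopologicalBasis Bs) (hC : ∀ I ∈ Bs, ∃ J ∈ Bs, Iᶜ ⊆ J) {x : Y}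
    (hunb : ∀ I ∈ Bs, ∀ D : ℝ, ∃ f ∈ fixingSubgroup G I, D < dist x (f • x))
    (hfac : ∀ g : G, ∃ P ∈ Bs, ∃ M ∈ Bs, Disjoint P M ∧
      ∃ a ∈ fixingSubgroup G P, ∃ b ∈ fixingSubgroup G M, a * b = g)
    {J₀ : Set X} (hJ₀ : J₀ ∈ Bs) (g : G) (R : ℝ) :
    ∃ L : ℝ, ∀ k ∈ fixingSubgroup G J₀, L ≤ dist x (k • x) →
      R ≤ gromovProd dist x (k • x) (g • k • x) := by
  obtain ⟨P, hP, M, hM, -, a, ha, b, hb, rfl⟩ := hfac g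
  set S := dist x (a • x) + dist x (b • x)
  refine ⟨max 0 (2 * (R + S + 3 * δ) + 3 * δ), fun k hk hLk => ?_⟩
  have hL0 := le_max_left 0 (2 * (R + S + 3 * δ) + 3 * δ)
  have hLR := le_max_right 0 (2 * (R + S + 3 * δ) + 3 * δ)
  have h1 := gromovProd_smul_ge_of_mem_fixingSubgroup hY hδ hbasis hC hunb hP hJ₀ ha hk hL0 hLk
  have h2 := gromovProd_smul_ge_of_mem_fixingSubgroup hY hδ hbasis hC hunb hM hJ₀ hb hk hL0 hLk
  have h3 := gromovProd_smul_smul_ge a x (k • x) (b • k • x)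
  have ha0 := dist_nonneg (x := x) (y := a • x)
  have hb0 := dist_nonneg (x := x) (y := b • x)
  have h4 := hY.le_gromovProd_of_le (w := x) (x := k • x) (y := a • b • k • x) (a • k • x)
    (r := R + δ) (by linarith) (by linarith)
  rw [mul_smul]
  linarith

/-- If the pointwise fixers of basic sets have unbounded orbits, any two loxodromic elements have
orbit rays at finite Hausdorff distance. -/
theorem exists_finHausdorffClose_of_unbounded (hY : FourPointWith Y δ) (hδ : 0 ≤ δ)
    (hbasis : TopologicalSpace.IsTopologicalBasis Bs) (hC : ∀ I ∈ Bs, ∃ J ∈ Bs, Iᶜ ⊆ J) {x : Y}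
    (hunb : ∀ I ∈ Bs, ∀ D : ℝ, ∃ f ∈ fixingSubgroup G I, D < dist x (f • x))
    (hfac : ∀ g : G, ∃ P ∈ Bs, ∃ M ∈ Bs, Disjoint P M ∧
      ∃ a ∈ fixingSubgroup G P, ∃ b ∈ fixingSubgroup G M, a * b = g)
    {g h : G} (hg : LinearGrowth g x) (hh : LinearGrowth h x) :
    ∃ s t : Bool, FinHausdorffClose dist
      (Set.range fun n : ℕ => (if s then g else g⁻¹) ^ n • x)
      (Set.range fun n : ℕ => (if t then h else h⁻¹) ^ n • x) := by
  have hsign : ∀ {f : G}, LinearGrowth f x → ∀ s : Bool, LinearGrowth (if s then f else f⁻¹) x := by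
    intro f hf s
    cases s
    · exact hf.inv
    · exact hf
  suffices hk : ∃ s t : Bool, ∀ R : ℝ, ∃ k : ℕ, R ≤ gromovProd dist x
      ((if s then g else g⁻¹) ^ k • x) ((if t then h else h⁻¹) ^ k • x) by
    obtain ⟨s, t, hst⟩ := hk
    exact ⟨s, t, hY.finHausdorffClose_range_pow hδ (hsign hg s) (hsign hh t) hst⟩
  by_contra! hfar
  choose R hR using hfar
  obtain ⟨C, hRC⟩ : ∃ C : ℝ, ∀ s t, R s t ≤ C := by
    obtain ⟨C, hC⟩ := (Set.finite_range fun p : Bool × Bool => R p.1 p.2).bddAbove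
    exact ⟨C, fun s t => hC ⟨(s, t), rfl⟩⟩
  obtain ⟨n, hgn, hhn⟩ : ∃ n : ℕ, 2 * (C + δ) + δ ≤ dist x (g ^ n • x) ∧
      2 * (C + δ) + δ ≤ dist x (h ^ n • x) := by
    obtain ⟨A, B, hA, hgA⟩ := hg
    obtain ⟨A', B', hA', hhA⟩ := hh
    obtain ⟨n, hn⟩ := exists_nat_ge (max ((2 * (C + δ) + δ + B) * A) ((2 * (C + δ) + δ + B') * A'))
    have h1 := (le_div_iff₀ hA).2 ((le_max_left _ _).trans hn)
    have h2 := (le_div_iff₀ hA').2 ((le_max_right _ _).trans hn)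
    exact ⟨n, by linarith [hgA n], by linarith [hhA n]⟩
  obtain ⟨J₀, hJ₀, -⟩ := hfac 1
  obtain ⟨L, hL⟩ := exists_forall_le_gromovProd_smul hY hδ hbasis hC hunb hfac hJ₀ (g ^ n)
    (dist x (g ^ n • x))
  obtain ⟨L', hL'⟩ := exists_forall_le_gromovProd_smul hY hδ hbasis hC hunb hfac hJ₀ (h ^ n)
    (dist x (h ^ n • x))
  obtain ⟨k, hk, hkL⟩ := hunb J₀ hJ₀ (max L L')
  have toward : ∀ f : G, 2 * (C + δ) + δ ≤ dist x (f ^ n • x) →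
      dist x (f ^ n • x) ≤ gromovProd dist x (k • x) (f ^ n • k • x) →
      ∃ s : Bool, C + δ ≤ gromovProd dist x (k • x) ((if s then f else f⁻¹) ^ n • x) := by
    intro f hfn hf
    rcases hY.le_gromovProd_or_of_le (f ^ n) hf with h1 | h1
    · exact ⟨true, by simp only [if_true]; linarith⟩
    · exact ⟨false, by simp only [Bool.false_eq_true, if_false, inv_pow]; linarith⟩
  obtain ⟨s, hs⟩ := toward g hgn (hL k hk ((le_max_left _ _).trans hkL.le))
  obtain ⟨t, ht⟩ := toward h hhn (hL' k hk ((le_max_right _ _).trans hkL.le))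
  rw [gromovProd_comm] at hs
  linarith [hY.le_gromovProd_of_le (k • x) hs ht, hR s t n, hRC s t]

end Dynamics

/-- [PropNL, Theorem 5.1]: the dynamical criterion ruling out general type
hyperbolic actions. -/
theorem stmt_16 {G : Type uG} [Group G] {X : Type*} [TopologicalSpace X] [CompactSpace X]
    [T2Space X] (τ : G → X → X)
    (τ_one : ∀ x : X, τ 1 x = x)
    (τ_mul : ∀ (g h : G) (x : X), τ (g * h) x = τ g (τ h x))
    (τ_cont : ∀ g : G, Continuous (τ g))
    (τ_faithful : ∀ g : G, (∀ x : X, τ g x = x) → g = 1)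
    (Bs : Set (Set X)) (hbasis : TopologicalSpace.IsTopologicalBasis Bs)
    (hne : ∀ I ∈ Bs, I.Nonempty) (hnd : ∀ I ∈ Bs, ¬ Dense I)
    -- (C) Complements
    (hC : ∀ I ∈ Bs, ∃ J ∈ Bs, Iᶜ ⊆ J)
    -- G preserves Bs
    (hpres : ∀ g : G, ∀ I ∈ Bs, τ g '' I ∈ Bs)
    -- (2T) Double transitivity on disjoint pairs
    (h2T : ∀ I J I' J' : Set X, I ∈ Bs → J ∈ Bs → Disjoint I J →
      I' ∈ Bs → J' ∈ Bs → Disjoint I' J' →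
        ∃ g : G, τ g '' I = I' ∧ τ g '' J = J')
    -- (3T) Weak triple transitivity
    (h3T : ∀ g h : G, ∃ M N P : Set X, M ∈ Bs ∧ N ∈ Bs ∧ P ∈ Bs ∧
      Disjoint M N ∧ Disjoint M P ∧ Disjoint N P ∧
      ∃ b : G, τ b '' M = τ g '' M ∧ τ b '' N = τ h '' N ∧ τ b '' P = P)
    -- (L) Local action
    (hL : ∀ I J K : Set X, I ∈ Bs → J ∈ Bs → K ∈ Bs →
      Disjoint I J → Disjoint I K → Disjoint J K →
      ∀ g h : G, τ g '' I = I → τ h '' J = J →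
        ∃ b : G, (∀ x ∈ I, τ b x = τ g x) ∧ (∀ x ∈ J, τ b x = τ h x) ∧ (∀ x ∈ K, τ b x = x)) :
    ∀ A : GrpActHypSpace.{uX, uG} G, ∀ g h : G,
      LoxodromicWith (fun a b : A.carrier => dist a b) A.act g →
      LoxodromicWith (fun a b : A.carrier => dist a b) A.act h →
      ∀ x : A.carrier, ¬ IndepWith (fun a b : A.carrier => dist a b) A.act x g h := by
  intro A g h hg hh x hind
  let _ : MulAction G X := { smul := τ, one_smul := τ_one, mul_smul := τ_mul }
  let _ : MulAction G A.carrier :=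
    { smul := A.act, one_smul := A.isIsomAction.act_one, mul_smul := A.isIsomAction.act_mul }
  have : IsIsometricSMul G A.carrier :=
    ⟨fun g => Isometry.of_dist_eq (A.isIsomAction.isometry g)⟩
  have : FaithfulSMul G X := ⟨fun {a b} hab => by
    refine inv_mul_eq_one.1 (τ_faithful _ fun y => ?_)
    exact (mul_smul a⁻¹ b y).trans (by rw [← hab y, inv_smul_smul])⟩
  have hY : FourPointWith A.carrier (3 * A.δ + 2) := A.rips.fourPointWith A.δ_nonneg A.geodesic
  have hδ : 0 ≤ 3 * A.δ + 2 := by linarith [A.δ_nonneg]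
  have hgrow : ∀ f : G, LoxodromicWith (fun a b : A.carrier => dist a b) A.act f →
      LinearGrowth f x := by
    rintro f ⟨y, K, B, hK, -, hf⟩
    refine LinearGrowth.congr (x := y) ⟨K, B, by linarith, fun n => ?_⟩ x
    have h0 := (hf 0 n).1
    simp only [zdist, zpow_zero, zpow_natCast, Int.cast_zero, Int.cast_natCast, zero_sub, abs_neg,
      Nat.abs_cast, A.isIsomAction.act_one] at h0
    exact h0
  have htrans : ∀ I ∈ Bs, ∀ I' ∈ Bs, ∃ g : G, τ g '' I = I' := fun I hI I' hI' =>
    exists_smul_eq_of_disjoint_transitive hbasis hnd h2T hI hI'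
  have hfac := exists_mul_eq_of_weak_triple_transitive (G := G) (X := X) h3T hL
  by_cases hunb : ∀ I ∈ Bs, ∀ D : ℝ, ∃ f ∈ fixingSubgroup G I, D < dist x (f • x)
  · obtain ⟨s, t, hst⟩ := exists_finHausdorffClose_of_unbounded hY hδ hbasis hC hunb hfac
      (hgrow g hg) (hgrow h hh)
    refine hind s t ?_
    have hray : ∀ (f : G) (s : Bool), orbitRay A.act f x s =
        Set.range fun n : ℕ => (if s then f else f⁻¹) ^ n • x := by
      intro f s
      cases s
      · simp only [orbitRay, Bool.false_eq_true, if_false, zpow_neg, zpow_natCast, inv_pow]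
        rfl
      · simp only [orbitRay, if_true, zpow_natCast]
        rfl
    rw [hray, hray]
    exact hst
  · push Not at hunb
    obtain ⟨I, hI, D, hD⟩ := hunb
    exact not_linearGrowth_of_bounded htrans h2T hfac hI hD g (hgrow g hg)
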